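/- arXiv:2201.06032 — 5 statements merged into one kernel-verified Lean document; each statement's English description precedes it below -/
import Mathlib

section
/- For every natural number r ≥ 1 and every formal power series g ∈ ℂ⟦X⟧, the order of g² − X^{2r+1} is at most 2r + 1. -/
open PowerSeries

/-- The square of a power series over a domain never has odd order. -/
theorem PowerSeries.order_sq_ne_odd {R : Type*} [Semiring R] [NoZeroDivisors R]
    (g : PowerSeries R) (r : ℕ) : (g ^ 2).order ≠ ((2 * r + 1 : ℕ) : ℕ∞) := by
  rw [pow_two, order_mul]
  cases g.order with
  | top => exact ENat.top_ne_natCast _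
  | coe n =>
    norm_cast
    lia

/-- Proposition 2.2(iii), first claim: for every `g ∈ ℂ⟦X⟧`, the order of
`g² − X^{2r+1}` is at most `2r+1`. -/
theorem stmt_3 (r : ℕ) (hr : 1 ≤ r) (g : PowerSeries ℂ) :
    (g ^ 2 - (PowerSeries.X : PowerSeries ℂ) ^ (2 * r + 1)).order ≤ ((2 * r + 1 : ℕ) : ℕ∞) := by
  have hX : (-(X : PowerSeries ℂ) ^ (2 * r + 1)).order = ((2 * r + 1 : ℕ) : ℕ∞) := by
    rw [order_neg, order_X_pow]
  rw [sub_eq_add_neg, order_add_of_order_ne _ _ (hX ▸ order_sq_ne_odd g r), hX]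
  exact inf_le_right
end

section
/- Let m ≥ 1 and let ψ : ℂ[X,Y] → ℂ[T] be the ℂ-algebra homomorphism with ψ(X) = T² and ψ(Y) = T^{2m+1}. Then the preimage (Ideal.comap) under ψ of the principal ideal generated by T^{2m} in ℂ[T] equals the ideal of ℂ[X,Y] generated by Y and X^m. -/
open MvPolynomial

/-- Modulo `Y`, every polynomial in `X, Y` is a polynomial in `X`. -/
theorem exists_X_one_dvd_sub_aeval {R : Type*} [CommRing R] (p : MvPolynomial (Fin 2) R) :
    ∃ q : Polynomial R, (X 1 : MvPolynomial (Fin 2) R) ∣ p - Polynomial.aeval (X 0) q := by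
  induction p using MvPolynomial.induction_on with
  | C a => exact ⟨Polynomial.C a, by simp [MvPolynomial.algebraMap_eq]⟩
  | add p₁ p₂ h₁ h₂ =>
    obtain ⟨q₁, h₁⟩ := h₁
    obtain ⟨q₂, h₂⟩ := h₂
    refine ⟨q₁ + q₂, ?_⟩
    rw [map_add, add_sub_add_comm]
    exact dvd_add h₁ h₂
  | mul_X p i h =>
    obtain ⟨q, h⟩ := h
    fin_cases i
    · refine ⟨q * Polynomial.X, ?_⟩
      simpa [sub_mul] using h.mul_right (X 0)
    · exact ⟨0, by simp⟩

theorem Polynomial.X_pow_mul_dvd_expand_iff {R : Type*} [CommSemiring R] {n : ℕ} (hn : 0 < n)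
    (m : ℕ) (q : Polynomial R) :
    (Polynomial.X : Polynomial R) ^ (n * m) ∣ Polynomial.expand R n q ↔ Polynomial.X ^ m ∣ q := by
  refine ⟨fun h => ?_, fun h => ?_⟩
  · rw [Polynomial.X_pow_dvd_iff] at h ⊢
    intro d hd
    rw [← Polynomial.coeff_expand_mul' hn]
    exact h _ (Nat.mul_lt_mul_of_pos_left hd hn)
  · simpa [pow_mul] using _root_.map_dvd (Polynomial.expand R n) h

/-- Theorem 2.1(b), key step: for `ψ : ℂ[X,Y] → ℂ[T]` with `ψ(X) = T²`, `ψ(Y) = T^{2m+1}`,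
the preimage of the ideal `(T^{2m})` is the ideal `(Y, X^m)`. -/
theorem stmt_6 (m : ℕ) (hm : 1 ≤ m)
    (ψ : MvPolynomial (Fin 2) ℂ →ₐ[ℂ] Polynomial ℂ)
    (hψX : ψ (MvPolynomial.X 0) = Polynomial.X ^ 2)
    (hψY : ψ (MvPolynomial.X 1) = Polynomial.X ^ (2 * m + 1)) :
    Ideal.comap ψ (Ideal.span {(Polynomial.X : Polynomial ℂ) ^ (2 * m)}) =
      Ideal.span {(MvPolynomial.X 1 : MvPolynomial (Fin 2) ℂ), MvPolynomial.X 0 ^ m} := by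
  have hY : (Polynomial.X : Polynomial ℂ) ^ (2 * m) ∣ ψ (X 1) :=
    hψY ▸ pow_dvd_pow _ (Nat.le_succ _)
  apply le_antisymm
  · intro p hp
    rw [Ideal.mem_comap, Ideal.mem_span_singleton] at hp
    obtain ⟨q, hq⟩ := exists_X_one_dvd_sub_aeval p
    have hψq : ψ (Polynomial.aeval (X 0) q) = Polynomial.expand ℂ 2 q := by
      rw [← Polynomial.aeval_algHom_apply, hψX, Polynomial.expand_eq_comp_X_pow, Polynomial.comp_eq_aeval]
    have hdvd : (Polynomial.X : Polynomial ℂ) ^ (2 * m) ∣ Polynomial.expand ℂ 2 q := by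
      have h := dvd_sub hp (hY.trans (map_dvd ψ hq))
      rwa [map_sub, sub_sub_cancel, hψq] at h
    rw [Polynomial.X_pow_mul_dvd_expand_iff two_pos] at hdvd
    have hX : (X 0 : MvPolynomial (Fin 2) ℂ) ^ m ∣ Polynomial.aeval (X 0) q := by
      simpa using map_dvd (Polynomial.aeval (X 0 : MvPolynomial (Fin 2) ℂ)) hdvd
    rw [← sub_add_cancel p (Polynomial.aeval (X 0) q)]
    exact add_mem (Ideal.mem_of_dvd _ hq (Ideal.subset_span (by simp)))
      (Ideal.mem_of_dvd _ hX (Ideal.subset_span (by simp)))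
  · rw [Ideal.span_le]
    rintro p (rfl | rfl)
    · exact Ideal.mem_comap.2 (Ideal.mem_span_singleton.2 hY)
    · exact Ideal.mem_comap.2 (Ideal.mem_span_singleton.2 (by rw [map_pow, hψX, pow_mul]))
end

section
/- Let m ≥ 1 and let ψ : ℂ[X,Y] → ℂ[T] be the ℂ-algebra homomorphism with ψ(X) = T² and ψ(Y) = T^{2m+1}. Then the preimage (Ideal.comap) under ψ of the principal ideal generated by T^{2m+2} in ℂ[T] equals the ideal of ℂ[X,Y] generated by X^{m+1}, X·Y and Y². -/
open MvPolynomial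

/-- A bivariate monomial under the substitution `X ↦ T ^ a`, `Y ↦ T ^ b`. -/
lemma MvPolynomial.algHom_monomial_of_X_pow {R : Type*} [CommSemiring R] {a b : ℕ}
    (ψ : MvPolynomial (Fin 2) R →ₐ[R] Polynomial R)
    (hX : ψ (X 0) = Polynomial.X ^ a) (hY : ψ (X 1) = Polynomial.X ^ b)
    (s : Fin 2 →₀ ℕ) (c : R) :
    ψ (monomial s c) = Polynomial.monomial (a * s 0 + b * s 1) c := by
  rw [monomial_eq, Finsupp.prod_fintype _ _ (fun _ => pow_zero _), Fin.prod_univ_two]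
  simp only [map_mul, map_pow, hX, hY, MvPolynomial.algHom_C, Polynomial.algebraMap_eq,
    ← pow_mul, ← pow_add, Polynomial.C_mul_X_pow_eq_monomial]

/-- The coefficients of a bivariate polynomial under the substitution `X ↦ T ^ a`, `Y ↦ T ^ b`. -/
lemma MvPolynomial.coeff_algHom_of_X_pow {R : Type*} [CommSemiring R] {a b : ℕ}
    (ψ : MvPolynomial (Fin 2) R →ₐ[R] Polynomial R)
    (hX : ψ (X 0) = Polynomial.X ^ a) (hY : ψ (X 1) = Polynomial.X ^ b)
    (p : MvPolynomial (Fin 2) R) (n : ℕ) :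
    (ψ p).coeff n = ∑ s ∈ p.support, if a * s 0 + b * s 1 = n then p.coeff s else 0 := by
  conv_lhs => rw [p.as_sum]
  simp only [map_sum, algHom_monomial_of_X_pow ψ hX hY, Polynomial.finsetSum_coeff,
    Polynomial.coeff_monomial]

/-- Bidegrees of weight at most `2 * m + 1` for the weights `(2, 2 * m + 1)` are determined by
their weight. -/
lemma eq_of_cusp_weight_eq {m : ℕ} (hm : 1 ≤ m) {s t : Fin 2 →₀ ℕ}
    (hs : 2 * s 0 + (2 * m + 1) * s 1 < 2 * m + 2)
    (h : 2 * t 0 + (2 * m + 1) * t 1 = 2 * s 0 + (2 * m + 1) * s 1) : t = s := by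
  have key : ∀ a b : ℕ, 2 * a + (2 * m + 1) * b < 2 * m + 2 → b = 0 ∨ b = 1 := by
    intro a b hab
    by_contra! hb
    have : 2 ≤ b := by omega
    nlinarith
  have h0 : t 0 = s 0 ∧ t 1 = s 1 := by
    rcases key _ _ hs with h1 | h1 <;> rcases key _ _ (h ▸ hs) with h2 | h2 <;>
      rw [h1, h2] at h <;> rw [h1] at hs <;> omega
  ext i
  fin_cases i
  · exact h0.1
  · exact h0.2

/-- Monomials of weight at least `2 * m + 2` lie in `(X ^ (m + 1), X * Y, Y ^ 2)`. -/
lemma monomial_mem_span_of_le_cusp_weight {R : Type*} [CommSemiring R] {m : ℕ}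
    {s : Fin 2 →₀ ℕ} (hs : 2 * m + 2 ≤ 2 * s 0 + (2 * m + 1) * s 1) (c : R) :
    monomial s c ∈ Ideal.span {(X 0 : MvPolynomial (Fin 2) R) ^ (m + 1), X 0 * X 1, X 1 ^ 2} := by
  rw [monomial_eq, Finsupp.prod_fintype _ _ (fun _ => pow_zero _), Fin.prod_univ_two]
  refine Ideal.mul_mem_left _ _ ?_
  rcases (by omega : s 1 = 0 ∨ s 1 = 1 ∨ 2 ≤ s 1) with h | h | h
  · rw [h] at hs
    exact Ideal.mul_mem_right _ _ (Ideal.mem_of_dvd _ (pow_dvd_pow _ (by omega : m + 1 ≤ s 0))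
      (Ideal.subset_span (by simp)))
  · rw [h] at hs
    exact Ideal.mem_of_dvd _ (mul_dvd_mul (dvd_pow_self _ (by omega)) (dvd_pow_self _ (by omega)))
      (Ideal.subset_span (by simp))
  · exact Ideal.mul_mem_left _ _ (Ideal.mem_of_dvd _ (pow_dvd_pow _ h)
      (Ideal.subset_span (by simp)))

/-- Theorem 2.1(b), maximality step: for `ψ : ℂ[X,Y] → ℂ[T]` with `ψ(X) = T²`,
`ψ(Y) = T^{2m+1}`, the preimage of the ideal `(T^{2m+2})` is the ideal `(X^{m+1}, XY, Y²)`. -/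
theorem stmt_7 (m : ℕ) (hm : 1 ≤ m)
    (ψ : MvPolynomial (Fin 2) ℂ →ₐ[ℂ] Polynomial ℂ)
    (hψX : ψ (MvPolynomial.X 0) = Polynomial.X ^ 2)
    (hψY : ψ (MvPolynomial.X 1) = Polynomial.X ^ (2 * m + 1)) :
    Ideal.comap ψ (Ideal.span {(Polynomial.X : Polynomial ℂ) ^ (2 * m + 2)}) =
      Ideal.span {(MvPolynomial.X 0 : MvPolynomial (Fin 2) ℂ) ^ (m + 1),
        MvPolynomial.X 0 * MvPolynomial.X 1, MvPolynomial.X 1 ^ 2} := by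
  apply le_antisymm
  · intro p hp
    rw [Ideal.mem_comap, Ideal.mem_span_singleton, Polynomial.X_pow_dvd_iff] at hp
    rw [p.as_sum]
    refine Ideal.sum_mem _ fun s hs => ?_
    refine monomial_mem_span_of_le_cusp_weight ?_ _
    by_contra! hlt
    have hcoeff := hp _ hlt
    rw [coeff_algHom_of_X_pow ψ hψX hψY, Finset.sum_eq_single_of_mem s hs, if_pos rfl] at hcoeff
    · exact mem_support_iff.mp hs hcoeff
    · intro t _ hts
      exact if_neg fun h => hts (eq_of_cusp_weight_eq hm hlt h)
  · rw [Ideal.span_le]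
    rintro _ (rfl | rfl | rfl) <;>
      simp only [SetLike.mem_coe, Ideal.mem_comap, Ideal.mem_span_singleton, map_pow, map_mul,
        hψX, hψY, ← pow_mul, ← pow_add] <;>
      exact pow_dvd_pow _ (by omega)
end

section
/- Let m ≥ 1. In the polynomial ring ℂ[X,Y], the intersection of the ideal generated by Y − X^m and X^{m+1} with the ideal generated by Y + X^m and X^{m+1} equals the ideal generated by X^{m+1}, X·Y and Y², i.e. Ideal.span {Y − X^m, X^{m+1}} ⊓ Ideal.span {Y + X^m, X^{m+1}} = Ideal.span {X^{m+1}, X·Y, Y²}. -/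
open MvPolynomial

theorem exists_eq_C_add_X_mul_add_X_mul {R : Type*} [CommRing R] (a : MvPolynomial (Fin 2) R) :
    ∃ p q : MvPolynomial (Fin 2) R, a = C (eval 0 a) + X 0 * p + X 1 * q := by
  induction a using MvPolynomial.induction_on with
  | C r => exact ⟨0, 0, by simp⟩
  | add f g hf hg =>
    obtain ⟨p, q, hf⟩ := hf
    obtain ⟨p', q', hg⟩ := hg
    refine ⟨p + p', q + q', ?_⟩
    rw [map_add, map_add]
    linear_combination hf + hg
  | mul_X f i _ =>
    fin_cases i
    · exact ⟨f, 0, by simp [mul_comm]⟩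
    · exact ⟨0, f, by simp [mul_comm]⟩

theorem eval_zero_aeval_polynomial {R : Type*} [CommRing R] (v : Fin 2 → Polynomial R)
    (hv : ∀ i, (v i).eval 0 = 0) (a : MvPolynomial (Fin 2) R) :
    (aeval v a).eval 0 = eval 0 a := by
  induction a using MvPolynomial.induction_on with
  | C r => simp
  | add f g hf hg => simp [hf, hg]
  | mul_X f i _ => simp [hv]

/-- Theorem 2.1(a), maximality: in `ℂ[X,Y]`,
`(Y − X^m, X^{m+1}) ∩ (Y + X^m, X^{m+1}) = (X^{m+1}, XY, Y²)`. -/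
theorem stmt_10 (m : ℕ) (hm : 1 ≤ m) :
    Ideal.span {(MvPolynomial.X 1 : MvPolynomial (Fin 2) ℂ) - MvPolynomial.X 0 ^ m,
        MvPolynomial.X 0 ^ (m + 1)} ⊓
      Ideal.span {(MvPolynomial.X 1 : MvPolynomial (Fin 2) ℂ) + MvPolynomial.X 0 ^ m,
        MvPolynomial.X 0 ^ (m + 1)} =
    Ideal.span {(MvPolynomial.X 0 : MvPolynomial (Fin 2) ℂ) ^ (m + 1),
      MvPolynomial.X 0 * MvPolynomial.X 1, MvPolynomial.X 1 ^ 2} := by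
  obtain ⟨k, rfl⟩ : ∃ k, m = k + 1 := ⟨m - 1, by omega⟩
  apply le_antisymm
  · rintro f ⟨h₁, h₂⟩
    obtain ⟨a, b, hab⟩ := Ideal.mem_span_pair.1 h₁
    obtain ⟨c, d, hcd⟩ := Ideal.mem_span_pair.1 h₂
    have key : a * (X 1 - X 0 ^ (k + 1)) + b * X 0 ^ (k + 1 + 1) =
        c * (X 1 + X 0 ^ (k + 1)) + d * X 0 ^ (k + 1 + 1) := hab.trans hcd.symm
    have hsub : eval 0 a = eval 0 c := by
      have hv : ∀ i, ((![0, Polynomial.X] : Fin 2 → Polynomial ℂ) i).eval 0 = 0 := by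
        simp [Fin.forall_fin_two]
      have h := congrArg (aeval (![0, Polynomial.X] : Fin 2 → Polynomial ℂ)) key
      simp only [map_add, map_sub, map_mul, map_pow, aeval_X, Matrix.cons_val_zero,
        Matrix.cons_val_one, ne_eq, Nat.add_eq_zero_iff, one_ne_zero, and_false,
        not_false_eq_true, zero_pow, sub_zero, add_zero, mul_zero] at h
      rw [← eval_zero_aeval_polynomial _ hv a, mul_right_cancel₀ Polynomial.X_ne_zero h,
        eval_zero_aeval_polynomial _ hv]
    have hadd : eval 0 a + eval 0 c = 0 := by
      have hv : ∀ i, ((![Polynomial.X, 0] : Fin 2 → Polynomial ℂ) i).eval 0 = 0 := by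
        simp [Fin.forall_fin_two]
      have h := congrArg (aeval (![Polynomial.X, 0] : Fin 2 → Polynomial ℂ)) key
      simp only [map_add, map_sub, map_mul, map_pow, aeval_X, Matrix.cons_val_zero,
        Matrix.cons_val_one] at h
      have h' := mul_right_cancel₀ (pow_ne_zero (k + 1) (Polynomial.X_ne_zero (R := ℂ)))
        (show (aeval ![Polynomial.X, 0] a + aeval ![Polynomial.X, 0] c) * Polynomial.X ^ (k + 1) =
          ((aeval ![Polynomial.X, 0] b - aeval ![Polynomial.X, 0] d) * Polynomial.X) *
            Polynomial.X ^ (k + 1) by linear_combination -h)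
      rw [← eval_zero_aeval_polynomial _ hv a, ← eval_zero_aeval_polynomial _ hv c,
        ← Polynomial.eval_add, h']
      simp
    have ha : eval 0 a = 0 := by linear_combination (hsub + hadd) / 2
    obtain ⟨p, q, hpq⟩ := exists_eq_C_add_X_mul_add_X_mul a
    rw [ha, C_0, zero_add] at hpq
    refine Submodule.mem_span_triple.2 ⟨b - p, p - q * X 0 ^ k, q, ?_⟩
    simp only [smul_eq_mul]
    rw [← hab, hpq]
    ring
  · rw [Ideal.span_le]
    rintro f (rfl | rfl | rfl)
    · exact ⟨Ideal.mem_span_pair.2 ⟨0, 1, by ring⟩, Ideal.mem_span_pair.2 ⟨0, 1, by ring⟩⟩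
    · exact ⟨Ideal.mem_span_pair.2 ⟨X 0, 1, by ring⟩, Ideal.mem_span_pair.2 ⟨X 0, -1, by ring⟩⟩
    · exact ⟨Ideal.mem_span_pair.2 ⟨X 1 + X 0 ^ (k + 1), X 0 ^ k, by ring⟩,
        Ideal.mem_span_pair.2 ⟨X 1 - X 0 ^ (k + 1), X 0 ^ k, by ring⟩⟩
end

section
/- In the polynomial ring ℂ[X,Y], if a polynomial f lies in the ideal generated by Y − X² and X³ and has total degree at most 1, then f = 0. In other words, the ideal Ideal.span {Y − X², X³} contains no nonzero polynomial of degree ≤ 1. -/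
open MvPolynomial

/-- A polynomial of total degree at most one is an affine linear form. -/
theorem MvPolynomial.eq_C_add_sum_of_totalDegree_le_one {σ R : Type*} [Fintype σ] [CommSemiring R]
    {f : MvPolynomial σ R} (hf : f.totalDegree ≤ 1) :
    f = C (coeff 0 f) + ∑ i, C (coeff (Finsupp.single i 1) f) * X i := by
  classical
  ext m
  simp only [coeff_add, coeff_C, coeff_sum, coeff_C_mul, coeff_X]
  obtain h0 | h1 | h2 : m.degree = 0 ∨ m.degree = 1 ∨ 1 < m.degree := by lia
  · obtain rfl := (Finsupp.degree_eq_zero_iff m).mp h0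
    simp
  · obtain ⟨i, rfl⟩ := (Finsupp.sum_eq_one_iff m).mp h1
    simp [Finsupp.single_left_inj, eq_comm (a := (0 : σ →₀ ℕ))]
  · have hm : coeff m f = 0 := coeff_eq_zero_of_totalDegree_lt (hf.trans_lt h2)
    have hm0 : (0 : σ →₀ ℕ) ≠ m := by rintro rfl; simp at h2
    have hm1 : ∀ i, Finsupp.single i 1 ≠ m := by rintro i rfl; simp at h2
    simp [hm, hm0, hm1]

/-- Example 4.1: the ideal `(Y − X², X³)` of `ℂ[X,Y]` contains no nonzero polynomial of
total degree `≤ 1` (so the length-3 curvilinear scheme it defines lies on no line). -/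
theorem stmt_15 (f : MvPolynomial (Fin 2) ℂ)
    (hf : f ∈ Ideal.span {(MvPolynomial.X 1 : MvPolynomial (Fin 2) ℂ) - MvPolynomial.X 0 ^ 2,
      MvPolynomial.X 0 ^ 3})
    (hdeg : f.totalDegree ≤ 1) : f = 0 := by
  obtain ⟨a, b, hab⟩ := Ideal.mem_span_pair.mp hf
  let φ : MvPolynomial (Fin 2) ℂ →ₐ[ℂ] Polynomial ℂ := aeval ![Polynomial.X, Polynomial.X ^ 2]
  have hdvd : (Polynomial.X : Polynomial ℂ) ^ 3 ∣ φ f := by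
    refine ⟨φ b, ?_⟩
    rw [← hab]
    simp [φ, mul_comm]
  have hcoeff := Polynomial.X_pow_dvd_iff.mp hdvd
  have hlin := eq_C_add_sum_of_totalDegree_le_one hdeg
  rw [Fin.sum_univ_two] at hlin
  generalize coeff 0 f = c at hlin
  generalize coeff (Finsupp.single 0 1) f = p at hlin
  generalize coeff (Finsupp.single 1 1) f = q at hlin
  subst hlin
  have h0 := hcoeff 0 (by norm_num)
  have h1 := hcoeff 1 (by norm_num)
  have h2 := hcoeff 2 (by norm_num)
  simp [φ, Polynomial.coeff_X, Polynomial.coeff_C] at h0 h1 h2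
  simp [h0, h1, h2]
end
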